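/- Let n ≥ 3 be odd and set r² = 1/cos(π/n). For all i, j ∈ {1, …, n}, the correlator of the dichotomic measurements {e_i, ē_i} on A and {e_j, ē_j} on B performed on the maximally entangled polygon state φ satisfies E(e_i, e_j) = ((r² − 1)² + 4 r² cos(2π(i−j)/n)) / (1 + r²)². -/

import Mathlib

open Matrix Real

noncomputable section PolygonOdd

/-- `r_n = sqrt(sec(π/n))`. -/
def rn (n : ℕ) : ℝ := Real.sqrt (1 / Real.cos (π / n))

/-- Effects of the odd-`n` polygon model. -/
def eEff (n i : ℕ) : Fin 3 → ℝ :=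
  (1 / (1 + rn n ^ 2)) • ![rn n * Real.cos (2 * π * (i : ℝ) / (n : ℝ)),
                           rn n * Real.sin (2 * π * (i : ℝ) / (n : ℝ)), 1]

/-- The unit effect. -/
def uEff : Fin 3 → ℝ := ![0, 0, 1]

/-- Correlator of the dichotomic measurements with outcome-0 effects `a`, `b`
on the maximally entangled state (the identity matrix) of two odd-`n`
polygon systems. -/
def corr (a b : Fin 3 → ℝ) : ℝ :=
  a ⬝ᵥ (1 : Matrix (Fin 3) (Fin 3) ℝ) *ᵥ b
    + (uEff - a) ⬝ᵥ (1 : Matrix (Fin 3) (Fin 3) ℝ) *ᵥ (uEff - b)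
    - a ⬝ᵥ (1 : Matrix (Fin 3) (Fin 3) ℝ) *ᵥ (uEff - b)
    - (uEff - a) ⬝ᵥ (1 : Matrix (Fin 3) (Fin 3) ℝ) *ᵥ b

/-- Correlators on the maximally entangled state of two odd-`n` polygon
systems, with `r² = sec(π/n)`:
`E(e_i, e_j) = ((r² − 1)² + 4 r² cos(2π(i−j)/n)) / (1 + r²)²`. -/
theorem odd_polygon_correlators (n : ℕ) (hn : 3 ≤ n) (hodd : Odd n)
    (i j : ℕ) (hi1 : 1 ≤ i) (hin : i ≤ n) (hj1 : 1 ≤ j) (hjn : j ≤ n) :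
    corr (eEff n i) (eEff n j)
      = ((1 / Real.cos (π / (n : ℝ)) - 1) ^ 2
          + 4 * (1 / Real.cos (π / (n : ℝ))) *
              Real.cos (2 * π * ((i : ℝ) - (j : ℝ)) / (n : ℝ)))
        / (1 + 1 / Real.cos (π / (n : ℝ))) ^ 2 := by
  have hn' : (3:ℝ) ≤ (n:ℝ) := by exact_mod_cast hn
  have hc : 0 < Real.cos (π / (n : ℝ)) := by
    apply Real.cos_pos_of_mem_Ioo
    have h0 : 0 < π / (n : ℝ) := by positivity
    have h1 : π / (n : ℝ) < π / 2 :=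
      div_lt_div_of_pos_left Real.pi_pos (by norm_num) (by linarith)
    constructor <;> linarith [Real.pi_pos]
  have hr : rn n ^ 2 = 1 / Real.cos (π / (n : ℝ)) := by
    unfold rn
    exact Real.sq_sqrt (by positivity)
  have hang : 2 * π * ((i : ℝ) - (j : ℝ)) / (n : ℝ)
      = 2 * π * (i : ℝ) / (n : ℝ) - 2 * π * (j : ℝ) / (n : ℝ) := by ring
  rw [← hr, hang, Real.cos_sub]
  have hpos : 1 + rn n ^ 2 ≠ 0 := by positivity
  simp only [corr, eEff, uEff, Matrix.one_mulVec, dotProduct, Fin.sum_univ_three,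
    Pi.sub_apply, Pi.smul_apply, smul_eq_mul, Matrix.cons_val]
  generalize rn n = r at *
  field_simp
  ring

end PolygonOdd
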